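/- arXiv:math/0505415 — 2 statements merged into one kernel-verified Lean document; each statement's English description precedes it below -/
import Mathlib

section
/- For all integers 0 ≤ t ≤ k, d ≥ 2k, and n ≥ 2k+1, every graph G on n vertices with treewidth at most k contains a set S of vertices such that every vertex of S has degree at most d in G, the induced subgraph G[S] has treewidth at most t, and |S| ≥ ((d-2k+1)(t+1)n + k(k+1)(t+1)) / ((d - (3/2)k + 1)(k+1) + (1/2)t(t+1)). -/
/-- The degree of a vertex `v` in `G` (number of neighbours). -/
noncomputable def degN {V : Type*} (G : SimpleGraph V) (v : V) : ℕ :=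
  (G.neighborSet v).ncard

/-- `G` is a `k`-tree. This encodes the recursive definition (start with a `(k+1)`-clique and
repeatedly add a new vertex adjacent to exactly the vertices of an existing `k`-clique) via a
construction ordering `e : V ≃ Fin n`: the first `k+1` vertices form a clique, and every later
vertex is adjacent among the earlier vertices to exactly the `k` vertices of a clique `S`. -/
def IsKTree {V : Type*} (k : ℕ) (G : SimpleGraph V) : Prop :=
  ∃ (n : ℕ) (e : V ≃ Fin n),
    k + 1 ≤ n ∧
    (∀ i j : Fin n, i < j → (j : ℕ) < k + 1 → G.Adj (e.symm i) (e.symm j)) ∧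
    (∀ j : Fin n, k + 1 ≤ (j : ℕ) →
      ∃ S : Finset (Fin n), S.card = k ∧ (∀ i ∈ S, i < j) ∧
        (∀ i : Fin n, i < j → (G.Adj (e.symm i) (e.symm j) ↔ i ∈ S)) ∧
        (∀ i ∈ S, ∀ i' ∈ S, i ≠ i' → G.Adj (e.symm i) (e.symm i')))

/-- The treewidth of a graph `G`: the minimum `k` such that `G` is a spanning subgraph
of a `k`-tree. -/
noncomputable def treewidth {V : Type*} (G : SimpleGraph V) : ℕ :=
  sInf {k : ℕ | ∃ H : SimpleGraph V, IsKTree k H ∧ G ≤ H}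


open Finset in
theorem idx_sum {V : Type*} [LinearOrder V] (g : ℕ → ℕ) (X : Finset V) :
    ∑ v ∈ X, g (#{u ∈ X | u < v}) = ∑ j ∈ range #X, g j := by
  induction X using Finset.induction_on_max with
  | empty => simp
  | insert a s h ih =>
    have ha : a ∉ s := fun h' => lt_irrefl _ (h a h')
    rw [sum_insert ha, card_insert_of_notMem ha, sum_range_succ, ← ih, add_comm]
    congr 1
    · apply sum_congr rfl
      intro v hv
      congr 2
      ext u
      simp only [mem_filter, mem_insert]
      constructor
      · rintro ⟨rfl | h1, h2⟩
        · exact absurd (h v hv) (not_lt.2 h2.le)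
        · exact ⟨h1, h2⟩
      · rintro ⟨h1, h2⟩
        exact ⟨Or.inr h1, h2⟩
    · congr 2
      ext u
      simp only [mem_filter, mem_insert]
      constructor
      · rintro ⟨rfl | h1, h2⟩
        · exact absurd h2 (lt_irrefl _)
        · exact h1
      · intro h1
        exact ⟨Or.inr h1, h u h1⟩

open Finset in
theorem sum_min (k n : ℕ) :
    2 * ∑ j ∈ range n, min j k + k * (k + 1) = 2 * k * n + (k - n) * (k - n + 1) := by
  induction n with
  | zero => simp
  | succ n ih =>
    rw [sum_range_succ]
    rcases le_or_gt k n with h | h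
    · rw [min_eq_right h]
      have h1 : k - n = 0 := by omega
      have h2 : k - (n + 1) = 0 := by omega
      rw [h1] at ih
      rw [h2]
      linarith
    · rw [min_eq_left h.le]
      obtain ⟨r, rfl⟩ : ∃ r, k = n + 1 + r := ⟨k - (n + 1), by omega⟩
      have h1 : n + 1 + r - n = r + 1 := by omega
      have h2 : n + 1 + r - (n + 1) = r := by omega
      rw [h1] at ih
      rw [h2]
      linarith

open Finset in
theorem sum_sub (q n : ℕ) :
    2 * ∑ j ∈ range n, (q - j) + (q - n) * (q - n + 1) = q * (q + 1) := by
  induction n with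
  | zero => simp
  | succ n ih =>
    rw [sum_range_succ]
    rcases le_or_gt q n with h | h
    · have h1 : q - n = 0 := by omega
      have h2 : q - (n + 1) = 0 := by omega
      rw [h1] at ih ⊢
      rw [h2]
      linarith
    · obtain ⟨r, rfl⟩ : ∃ r, q = n + 1 + r := ⟨q - (n + 1), by omega⟩
      have h1 : n + 1 + r - n = r + 1 := by omega
      have h2 : n + 1 + r - (n + 1) = r := by omega
      rw [h1] at ih ⊢
      rw [h2]
      linarith

open Finset Classical in
theorem firstFit {V : Type*} [Fintype V] [LinearOrder V] (R : V → V → Prop) (s : Finset V) :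
    ∃ f : V → ℕ, (∀ v ∈ s, f v ≤ #{u ∈ s | u < v ∧ R u v}) ∧
      ∀ u ∈ s, ∀ v ∈ s, u < v → R u v → f u ≠ f v := by
  induction s using Finset.induction_on_max with
  | empty => exact ⟨fun _ => 0, by simp, by simp⟩
  | insert a s h ih =>
    obtain ⟨f, hf1, hf2⟩ := ih
    have ha : a ∉ s := fun h' => lt_irrefl _ (h a h')
    set B := {u ∈ s | u < a ∧ R u a} with hB
    obtain ⟨c, hc, hc'⟩ : ∃ c ∈ range (#B + 1), c ∉ B.image f := by
      apply exists_mem_notMem_of_card_lt_card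
      rw [card_range]
      exact Nat.lt_succ_of_le card_image_le
    have hne : ∀ v ∈ s, v ≠ a := fun v hv h' => ha (h' ▸ hv)
    refine ⟨Function.update f a c, ?_, ?_⟩
    · intro v hv
      rcases mem_insert.1 hv with rfl | hv
      · rw [Function.update_self]
        refine (Nat.lt_succ_iff.1 (mem_range.1 hc)).trans (card_le_card ?_)
        exact filter_subset_filter _ (subset_insert _ _)
      · rw [Function.update_of_ne (hne v hv)]
        exact (hf1 v hv).trans (card_le_card (filter_subset_filter _ (subset_insert _ _)))
    · intro u hu v hv huv hR
      rcases mem_insert.1 hv with rfl | hvs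
      · rcases mem_insert.1 hu with rfl | hu
        · exact absurd huv (lt_irrefl _)
        · rw [Function.update_self, Function.update_of_ne (hne u hu)]
          rintro rfl
          exact hc' (mem_image_of_mem f (by simp [hB, hu, huv, hR]))
      · rcases mem_insert.1 hu with rfl | hu
        · exact absurd (h v hvs) (not_lt.2 huv.le)
        · rw [Function.update_of_ne (hne u hu), Function.update_of_ne (hne v hvs)]
          exact hf2 u hu v hvs huv hR

open Finset Classical in
theorem edge_count {V : Type*} [Fintype V] [LinearOrder V] (H : SimpleGraph V) (L : Finset V) :
    ∑ v ∈ L, #{u ∈ L | u < v ∧ H.Adj u v} + ∑ v ∈ Lᶜ, #{u | H.Adj u v} =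
    ∑ v, #{u | u < v ∧ H.Adj u v} + ∑ v ∈ Lᶜ, #{u ∈ Lᶜ | u < v ∧ H.Adj u v} := by
  set I : V → V → ℕ := fun u v => if u < v ∧ H.Adj u v then 1 else 0 with hI
  have hA : ∀ u v, (if H.Adj u v then 1 else 0) = I u v + I v u := by
    intro u v
    simp only [hI, H.adj_comm v u]
    by_cases h : H.Adj u v
    · rcases lt_or_gt_of_ne h.ne with h' | h' <;> simp [h, h', h'.not_gt]
    · simp [h]
  simp only [card_filter, hA]
  change ∑ v ∈ L, ∑ u ∈ L, I u v + ∑ v ∈ Lᶜ, ∑ u, (I u v + I v u) =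
    ∑ v, ∑ u, I u v + ∑ v ∈ Lᶜ, ∑ u ∈ Lᶜ, I u v
  simp only [← sum_add_sum_compl L, sum_add_distrib]
  have h1 : ∑ x ∈ Lᶜ, ∑ y ∈ L, I x y = ∑ y ∈ L, ∑ x ∈ Lᶜ, I x y := sum_comm
  have h2 : ∑ x ∈ Lᶜ, ∑ y ∈ Lᶜ, I x y = ∑ y ∈ Lᶜ, ∑ x ∈ Lᶜ, I x y := sum_comm
  rw [h1, h2]
  ring

open Finset Classical in
theorem sortColour {V : Type*} [Fintype V] (L : Finset V) (k q : ℕ) (f : V → Fin (k + 1)) :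
    ∃ σ : Equiv.Perm (Fin (k + 1)),
      (∀ i j : Fin (k + 1), i ≤ j → #{v ∈ L | σ (f v) = j} ≤ #{v ∈ L | σ (f v) = i}) ∧
      ∑ v ∈ L, max (σ (f v) : ℕ) q ≤ ∑ v ∈ L, max (f v : ℕ) q := by
  set a : Fin (k + 1) → ℕ := fun i => #{v ∈ L | f v = i} with ha
  set b : Fin (k + 1) → ℕᵒᵈ := fun i => OrderDual.toDual (a i) with hb
  set τ := Tuple.sort b with hτ
  have hmono : Monotone (b ∘ τ) := Tuple.monotone_sort b
  have hanti : Antitone (a ∘ τ) := fun i j hij => hmono hij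
  have hcls : ∀ i, #{v ∈ L | τ.symm (f v) = i} = a (τ i) := by
    intro i
    simp only [ha, Equiv.symm_apply_eq]
  refine ⟨τ.symm, ?_, ?_⟩
  · intro i j hij
    rw [hcls, hcls]
    exact hanti hij
  · have key : ∀ g : V → Fin (k + 1), ∑ v ∈ L, max (g v : ℕ) q =
        ∑ i : Fin (k + 1), #{v ∈ L | g v = i} * max (i : ℕ) q := by
      intro g
      rw [← sum_fiberwise_of_maps_to (s := L) (t := univ) (g := g) (fun _ _ => mem_univ _)]
      apply sum_congr rfl
      intro i _
      rw [← smul_eq_mul, ← sum_const]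
      apply sum_congr rfl
      intro v hv
      rw [(mem_filter.1 hv).2]
    rw [key (fun v => τ.symm (f v)), key f]
    simp only [hcls]
    have hav : Antivary (a ∘ τ) (fun i : Fin (k + 1) => max (i : ℕ) q) := by
      apply hanti.antivary
      intro i j hij
      exact max_le_max_right _ hij
    have := hav.sum_smul_le_sum_comp_perm_smul (σ := τ.symm)
    simpa [ha] using this

open Finset in
theorem gain (k q m ℓ : ℕ) (a : ℕ → ℕ) (ha : ∀ i j, i ≤ j → j ≤ k → a j ≤ a i)
    (hq : q = k - m) (hs : ∑ i ∈ range (k + 1), a i = ℓ) (hl : 2 * k + 1 ≤ ℓ + m) :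
    q * (q + 1) + ∑ i ∈ range (k + 1), i * a i ≤ ∑ i ∈ range (k + 1), max i q * a i := by
  have h1 : ∑ i ∈ range (k + 1), max i q * a i =
      ∑ i ∈ range (k + 1), i * a i + ∑ i ∈ range (k + 1), (q - i) * a i := by
    rw [← sum_add_distrib]
    apply sum_congr rfl
    intro i _
    rw [← add_mul]
    congr 1
    omega
  rw [h1, add_comm]
  apply Nat.add_le_add_left
  have hqk : q ≤ k := by omega
  have h2 : ∑ i ∈ range q, (q - i) * a i ≤ ∑ i ∈ range (k + 1), (q - i) * a i :=
    sum_le_sum_of_subset (range_mono (by omega))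
  refine le_trans ?_ h2
  have h3 := sum_sub q q
  simp only [Nat.sub_self, zero_mul, add_zero] at h3
  rw [← h3, mul_sum]
  by_cases hall : ∀ i < q, 2 ≤ a i
  · apply sum_le_sum
    intro i hi
    rw [mul_comm]
    exact Nat.mul_le_mul_left _ (hall i (mem_range.1 hi))
  · push Not at hall
    obtain ⟨p', hp'⟩ := hall
    have hex : ∃ p, p < q ∧ a p < 2 := ⟨p', hp'⟩
    classical
    obtain ⟨hp1, hp2⟩ := Nat.find_spec hex
    have hmin := fun i (hi : i < Nat.find hex) => Nat.find_min hex hi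
    generalize Nat.find hex = p at *
    have hsmall : ∑ i ∈ Ico q (k + 1), a i ≤ k + 1 - q := by
      calc ∑ i ∈ Ico q (k + 1), a i ≤ ∑ i ∈ Ico q (k + 1), 1 := by
            apply sum_le_sum
            intro i hi
            rw [mem_Ico] at hi
            have := ha p i (by omega) (by omega)
            omega
        _ = _ := by simp
    have hsplit : ∑ i ∈ range q, a i + ∑ i ∈ Ico q (k + 1), a i = ℓ := by
      rw [sum_range_add_sum_Ico _ (by omega), hs]
    have h4 : 2 * q ≤ ∑ i ∈ range q, a i := by omega
    have h5 : ∀ i ∈ range q, ((q : ℤ) - p) * ((a i : ℤ) - 2) ≤ ((q - i : ℕ) : ℤ) * ((a i : ℤ) - 2) := by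
      intro i hi
      rw [mem_range] at hi
      rw [Nat.cast_sub hi.le]
      rcases lt_or_ge i p with hip | hip
      · have : 2 ≤ a i := by
          by_contra hcon
          exact hmin i hip ⟨hi, by omega⟩
        nlinarith
      · have := ha p i hip (by omega)
        have h6 : (a i : ℤ) - 2 ≤ 0 := by omega
        have h7 : (p : ℤ) ≤ i := by omega
        nlinarith
    have h6 := sum_le_sum h5
    rw [← mul_sum] at h6
    have h7 : ∑ i ∈ range q, ((a i : ℤ) - 2) = ((∑ i ∈ range q, a i : ℕ) : ℤ) - 2 * q := by
      rw [sum_sub_distrib]; simp; ring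
    have h8 : 0 ≤ ((q : ℤ) - p) * ∑ i ∈ range q, ((a i : ℤ) - 2) := by
      rw [h7]
      apply mul_nonneg <;> omega
    have h9 := h8.trans h6
    simp only [mul_sub, sum_sub_distrib] at h9
    zify
    have e1 : ∑ i ∈ range q, 2 * ((q - i : ℕ) : ℤ) = ∑ i ∈ range q, ((q - i : ℕ) : ℤ) * 2 :=
      sum_congr rfl (fun _ _ => mul_comm _ _)
    push_cast at *
    linarith

open Finset in
theorem numeric (k t d n m ℓ e E eM x : ℕ) (a : ℕ → ℕ) (htk : t ≤ k) (hd : 2 * k ≤ d)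
    (hn : 2 * k + 1 ≤ n) (hlm : ℓ + m = n)
    (ha : ∀ i j, i ≤ j → j ≤ k → a j ≤ a i) (hs : ∑ i ∈ range (k + 1), a i = ℓ)
    (h1 : ∑ i ∈ range (k + 1), max i (k - m) * a i ≤ e + x)
    (hx : 2 * x ≤ (k - m) * (k - m + 1))
    (h2 : e + (d + 1) * m ≤ E + eM)
    (hE : 2 * E + k * (k + 1) = 2 * k * n)
    (heM : 2 * eM + k * (k + 1) ≤ 2 * k * m + (k - m) * (k - m + 1)) :
    2 * ((t : ℤ) + 1) * (((d : ℤ) - 2 * k + 1) * n + k * (k + 1)) ≤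
      ((∑ i ∈ range (t + 1), a i : ℕ) : ℤ) *
        ((2 * (d : ℤ) - 3 * k + 2) * (k + 1) + t * (t + 1)) := by
  have hg := gain k (k - m) m ℓ a ha rfl hs (by omega)
  set q := k - m
  set s := ∑ i ∈ range (t + 1), a i with hsdef
  set D : ℤ := (d : ℤ) + 1 - k with hD
  -- the main inequality
  have hN : ((d : ℤ) - 2 * k + 1) * n + k * (k + 1) ≤
      ∑ i ∈ range (k + 1), (D - i) * (a i : ℤ) := by
    have e1 : ∑ i ∈ range (k + 1), (D - i) * (a i : ℤ) =
        D * ℓ - ((∑ i ∈ range (k + 1), i * a i : ℕ) : ℤ) := by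
      rw [← hs]
      push_cast
      rw [mul_sum, ← sum_sub_distrib]
      apply sum_congr rfl
      intro i _
      ring
    rw [e1]
    generalize ∑ i ∈ range (k + 1), i * a i = Y at *
    generalize ∑ i ∈ range (k + 1), max i q * a i = Z at *
    have hl : (ℓ : ℤ) = n - m := by omega
    rw [hl, hD]
    zify at hg h1 hx h2 hE heM
    nlinarith
  have hat : ∀ i, t < i → i ≤ k → (t + 1) * a i ≤ s := by
    intro i hi hik
    rw [hsdef]
    calc (t + 1) * a i = ∑ j ∈ range (t + 1), a i := by simp
      _ ≤ _ := by
        apply sum_le_sum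
        intro j hj
        rw [mem_range] at hj
        exact ha j i (by omega) hik
  have hsplit : ∑ i ∈ range (k + 1), (D - i) * (a i : ℤ) =
      ∑ i ∈ range (t + 1), (D - i) * (a i : ℤ) + ∑ i ∈ Ico (t + 1) (k + 1), (D - i) * (a i : ℤ) :=
    (sum_range_add_sum_Ico _ (by omega)).symm
  have hA : ∑ i ∈ range (t + 1), (D - i) * (a i : ℤ) ≤ D * s := by
    rw [hsdef]
    push_cast
    rw [mul_sum]
    apply sum_le_sum
    intro i _
    have : (0 : ℤ) ≤ (i : ℤ) * a i := by positivity
    linarith [sub_mul D (i : ℤ) (a i)]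
  have hB : ((t : ℤ) + 1) * ∑ i ∈ Ico (t + 1) (k + 1), (D - i) * (a i : ℤ) ≤
      ∑ i ∈ Ico (t + 1) (k + 1), (D - i) * (s : ℤ) := by
    rw [mul_sum]
    apply sum_le_sum
    intro i hi
    rw [mem_Ico] at hi
    have h := hat i (by omega) (by omega)
    have h' : ((t : ℤ) + 1) * a i ≤ s := by exact_mod_cast h
    have hDi : 0 ≤ D - i := by omega
    nlinarith
  have hC : 2 * ∑ i ∈ Ico (t + 1) (k + 1), (D - (i : ℤ)) =
      2 * D * (k - t) - (k * (k + 1) - t * (t + 1)) := by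
    have gen : ∀ r : ℕ, 2 * ∑ i ∈ range r, (D - (i : ℤ)) = 2 * D * r - r * (r - 1) := by
      intro r
      induction r with
      | zero => simp
      | succ r ih => rw [sum_range_succ, mul_add, ih]; push_cast; ring
    have h := sum_range_add_sum_Ico (fun i : ℕ => D - (i : ℤ)) (show t + 1 ≤ k + 1 by omega)
    have g1 := gen (t + 1)
    have g2 := gen (k + 1)
    push_cast at g1 g2
    linarith
  rw [← sum_mul] at hB
  generalize ∑ i ∈ Ico (t + 1) (k + 1), (D - (i : ℤ)) * (a i : ℤ) = P at *
  generalize ∑ i ∈ range (t + 1), (D - (i : ℤ)) * (a i : ℤ) = Q at *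
  generalize ∑ i ∈ Ico (t + 1) (k + 1), (D - (i : ℤ)) = R at *
  have ht : (0 : ℤ) < (t : ℤ) + 1 := by positivity
  calc 2 * ((t : ℤ) + 1) * (((d : ℤ) - 2 * k + 1) * n + k * (k + 1))
      ≤ 2 * ((t : ℤ) + 1) * (Q + P) := by
        rw [← hsplit]
        exact mul_le_mul_of_nonneg_left hN (by positivity)
    _ = 2 * ((t + 1) * Q) + 2 * ((t + 1) * P) := by ring
    _ ≤ 2 * ((t + 1) * (D * s)) + 2 * (R * s) := by
        have := mul_le_mul_of_nonneg_left hA ht.le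
        linarith
    _ = 2 * ((t + 1) * (D * s)) + (2 * D * (k - t) - (k * (k + 1) - t * (t + 1))) * s := by
        rw [← hC]; ring
    _ = _ := by rw [hD]; ring

open Finset in
/-- Extending back-neighbourhoods to those of a `k`-tree (on natural numbers). -/
theorem extendBack (k : ℕ) (N : ℕ → Finset ℕ) (n : ℕ)
    (hlt : ∀ j < n, ∀ i ∈ N j, i < j) (hc : ∀ j < n, #(N j) ≤ k)
    (hcl : ∀ j < n, ∀ i ∈ N j, ∀ i' ∈ N j, i < i' → i ∈ N i') :
    ∃ C : ℕ → Finset ℕ, ∀ j < n, (∀ i ∈ C j, i < j) ∧ N j ⊆ C j ∧ (j ≤ k → C j = range j) ∧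
      (k < j → #(C j) = k) ∧ (∀ i ∈ C j, ∀ i' ∈ C j, i < i' → i ∈ C i') := by
  induction n with
  | zero => exact ⟨fun _ => ∅, by simp⟩
  | succ n ih =>
    obtain ⟨C, hC⟩ := ih (fun j hj => hlt j (by omega)) (fun j hj => hc j (by omega))
      (fun j hj => hcl j (by omega))
    obtain ⟨T, hT1, hT2, hT3, hT4, hT5⟩ : ∃ T : Finset ℕ, (∀ i ∈ T, i < n) ∧ N n ⊆ T ∧
        (n ≤ k → T = range n) ∧ (k < n → #T = k) ∧
        (∀ i ∈ T, ∀ i' ∈ T, i < i' → i ∈ C i') := by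
      rcases le_or_gt n k with hnk | hnk
      · refine ⟨range n, by simp, fun i hi => mem_range.2 (hlt n (by omega) i hi), fun _ => rfl,
          fun h => absurd h (by omega), ?_⟩
        intro i hi i' hi' hii
        rw [mem_range] at hi hi'
        rw [(hC i' hi').2.2.1 (by omega)]
        exact mem_range.2 hii
      · obtain ⟨K, hK1, hK2, hK3, hK4⟩ : ∃ K : Finset ℕ, (∀ i ∈ K, i < n) ∧ N n ⊆ K ∧ #K = k + 1 ∧
            (∀ i ∈ K, ∀ i' ∈ K, i < i' → i ∈ C i') := by
          by_cases hw : ∃ w ∈ N n, k < w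
          · have hne : (N n).Nonempty := ⟨_, hw.choose_spec.1⟩
            set w := (N n).max' hne with hwdef
            have hwN : w ∈ N n := max'_mem _ _
            have hkw : k < w := by
              obtain ⟨w', h1, h2⟩ := hw
              exact lt_of_lt_of_le h2 (le_max' _ _ h1)
            have hwn : w < n := hlt n (by omega) w hwN
            have hCw := hC w hwn
            refine ⟨insert w (C w), ?_, ?_, ?_, ?_⟩
            · intro i hi
              rcases mem_insert.1 hi with rfl | hi
              · exact hwn
              · exact (hCw.1 i hi).trans hwn
            · intro i hi
              rcases (le_max' _ i hi).lt_or_eq with h | h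
              · exact mem_insert_of_mem (hCw.2.1 (hcl n (by omega) i hi w hwN h))
              · exact mem_insert.2 (Or.inl h)
            · rw [card_insert_of_notMem (fun h => lt_irrefl _ (hCw.1 w h)), hCw.2.2.2.1 hkw]
            · intro i hi i' hi' hii
              rcases mem_insert.1 hi' with rfl | hi'
              · rcases mem_insert.1 hi with rfl | hi
                · exact absurd hii (lt_irrefl _)
                · exact hi
              · rcases mem_insert.1 hi with rfl | hi
                · exact absurd (hCw.1 i' hi') (by omega)
                · exact hCw.2.2.2.2 i hi i' hi' hii
          · push Not at hw
            refine ⟨range (k + 1), ?_, ?_, by simp, ?_⟩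
            · intro i hi
              rw [mem_range] at hi
              omega
            · intro i hi
              rw [mem_range]
              have := hw i hi
              omega
            · intro i hi i' hi' hii
              rw [mem_range] at hi hi'
              rw [(hC i' (by omega)).2.2.1 (by omega)]
              exact mem_range.2 hii
        obtain ⟨T, h1, h2, h3⟩ := exists_subsuperset_card_eq hK2 (hc n (by omega))
          (show k ≤ #K by omega)
        exact ⟨T, fun i hi => hK1 i (h2 hi), h1, fun h => absurd h (by omega), fun _ => h3,
          fun i hi i' hi' => hK4 i (h2 hi) i' (h2 hi')⟩
    refine ⟨Function.update C n T, ?_⟩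
    intro j hj
    rcases Nat.lt_succ_iff_lt_or_eq.1 hj with hj | rfl
    · rw [Function.update_of_ne hj.ne]
      obtain ⟨g1, g2, g3, g4, g5⟩ := hC j hj
      refine ⟨g1, g2, g3, g4, ?_⟩
      intro i hi i' hi' hii
      have := g1 i' hi'
      rw [Function.update_of_ne (by omega)]
      exact g5 i hi i' hi' hii
    · rw [Function.update_self]
      refine ⟨hT1, hT2, hT3, hT4, ?_⟩
      intro i hi i' hi' hii
      have := hT1 i' hi'
      rw [Function.update_of_ne (by omega)]
      exact hT5 i hi i' hi' hii

open Finset Classical in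
theorem exists_ktree {V : Type*} [Fintype V] [LinearOrder V] (k : ℕ) (H : SimpleGraph V)
    (hk : k + 1 ≤ Fintype.card V)
    (hcl : ∀ v u w, u < v → w < v → u ≠ w → H.Adj u v → H.Adj w v → H.Adj u w)
    (hcard : ∀ v, #{u | u < v ∧ H.Adj u v} ≤ k) :
    ∃ H' : SimpleGraph V, IsKTree k H' ∧ H ≤ H' := by
  obtain ⟨n, hn⟩ : ∃ n, Fintype.card V = n := ⟨_, rfl⟩
  set e : V ≃o Fin n := (Fintype.orderIsoFinOfCardEq V hn).symm with he
  set p : V → ℕ := fun v => (e v : ℕ) with hp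
  have hpinj : Function.Injective p := fun a b h => e.injective (Fin.ext h)
  have hplt : ∀ u v, p u < p v ↔ u < v := fun u v => by
    rw [← e.lt_iff_lt]; exact Iff.rfl
  have hpsurj : ∀ j < n, ∃ v, p v = j := fun j hj => ⟨e.symm ⟨j, hj⟩, by simp [hp]⟩
  set N : ℕ → Finset ℕ := fun j =>
    if h : j < n then ({u | u < e.symm ⟨j, h⟩ ∧ H.Adj u (e.symm ⟨j, h⟩)} : Finset V).image p else ∅
    with hN
  have hNp : ∀ v, N (p v) = ({u | u < v ∧ H.Adj u v} : Finset V).image p := by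
    intro v
    simp [hN, hp]
  obtain ⟨C, hC⟩ := extendBack k N n
    (by
      intro j hj i hi
      obtain ⟨v, rfl⟩ := hpsurj j hj
      rw [hNp] at hi
      obtain ⟨u, hu, rfl⟩ := mem_image.1 hi
      exact (hplt _ _).2 (mem_filter.1 hu).2.1)
    (by
      intro j hj
      obtain ⟨v, rfl⟩ := hpsurj j hj
      rw [hNp]
      exact card_image_le.trans (hcard v))
    (by
      intro j hj i hi i' hi' hii
      obtain ⟨v, rfl⟩ := hpsurj j hj
      rw [hNp] at hi hi'
      obtain ⟨u, hu, rfl⟩ := mem_image.1 hi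
      obtain ⟨w, hw, rfl⟩ := mem_image.1 hi'
      rw [hNp]
      rw [mem_filter] at hu hw
      apply mem_image_of_mem
      rw [mem_filter]
      have huw := (hplt _ _).1 hii
      exact ⟨mem_univ _, huw, hcl v u w hu.2.1 hw.2.1 huw.ne hu.2.2 hw.2.2⟩)
  set H' : SimpleGraph V := SimpleGraph.fromRel (fun u v => p u ∈ C (p v)) with hH'
  have hpn : ∀ v, p v < n := fun v => (e v).2
  have hadj : ∀ u v, u < v → (H'.Adj u v ↔ p u ∈ C (p v)) := by
    intro u v huv
    rw [hH', SimpleGraph.fromRel_adj]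
    constructor
    · rintro ⟨_, h | h⟩
      · exact h
      · have h1 := (hC _ (hpn u)).1 _ h
        exact absurd ((hplt _ _).1 h1) huv.not_gt
    · intro h
      exact ⟨huv.ne, Or.inl h⟩
  have hple : ∀ i : Fin n, p (e.symm i) = i := fun i => by simp [hp]
  refine ⟨H', ⟨n, e.toEquiv, by omega, ?_, ?_⟩, ?_⟩
  · intro i j hij hj
    change H'.Adj (e.symm i) (e.symm j)
    rw [hadj _ _ (e.symm.lt_iff_lt.2 hij), hple, hple, (hC j j.2).2.2.1 (by omega)]
    exact mem_range.2 hij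
  · intro j hj
    obtain ⟨g1, g2, g3, g4, g5⟩ := hC j j.2
    refine ⟨({i : Fin n | (i : ℕ) ∈ C j} : Finset (Fin n)), ?_, ?_, ?_, ?_⟩
    · rw [← g4 (by omega)]
      rw [← card_image_of_injective _ (Fin.val_injective)]
      congr 1
      ext i
      simp only [mem_image, mem_filter, mem_univ, true_and]
      constructor
      · rintro ⟨a, ha, rfl⟩
        exact ha
      · intro hi
        exact ⟨⟨i, (g1 i hi).trans j.2⟩, hi, rfl⟩
    · intro i hi
      exact g1 i (mem_filter.1 hi).2
    · intro i hij
      change H'.Adj (e.symm i) (e.symm j) ↔ _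
      rw [hadj _ _ (e.symm.lt_iff_lt.2 hij), hple, hple]
      simp
    · intro i hi i' hi' hne
      change H'.Adj (e.symm i) (e.symm i')
      have h1 := (mem_filter.1 hi).2
      have h2 := (mem_filter.1 hi').2
      rcases lt_or_gt_of_ne hne with h | h
      · rw [hadj _ _ (e.symm.lt_iff_lt.2 h), hple, hple]
        exact g5 _ h1 _ h2 h
      · rw [H'.adj_comm, hadj _ _ (e.symm.lt_iff_lt.2 h), hple, hple]
        exact g5 _ h2 _ h1 h
  · have main : ∀ u v, u < v → H.Adj u v → H'.Adj u v := by
      intro u v huv h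
      rw [hadj u v huv]
      apply (hC _ (hpn v)).2.1
      rw [hNp]
      exact mem_image_of_mem _ (by simp [huv, h])
    intro u v h
    rcases lt_or_gt_of_ne h.ne with h' | h'
    · exact main u v h' h
    · exact (main v u h' h.symm).symm

open Finset Classical in
theorem ktree_order {V : Type*} [Fintype V] (k : ℕ) (H : SimpleGraph V) (h : IsKTree k H) :
    ∃ _ : LinearOrder V,
      (∀ v u w, u < v → w < v → u ≠ w → H.Adj u v → H.Adj w v → H.Adj u w) ∧
      (∀ v, #{u | u < v ∧ H.Adj u v} = min #{u | u < v} k) ∧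
      (∀ v, #{u | u < v} ≤ k → ∀ u, u < v → H.Adj u v) := by
  obtain ⟨n, e, hkn, h1, h2⟩ := h
  let _ : LinearOrder V := LinearOrder.lift' e e.injective
  have hlt : ∀ u v : V, u < v ↔ e u < e v := fun u v => Iff.rfl
  have hidx : ∀ v : V, #{u | u < v} = (e v : ℕ) := by
    intro v
    rw [← Fin.card_Iio (e v), ← card_image_of_injective _ e.injective]
    congr 1
    ext i
    simp only [mem_image, mem_filter, mem_univ, true_and, mem_Iio]
    constructor
    · rintro ⟨u, hu, rfl⟩
      exact hu
    · intro hi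
      exact ⟨e.symm i, by rw [hlt]; simpa using hi, by simp⟩
  have hsmall : ∀ v, #{u | u < v} ≤ k → ∀ u, u < v → H.Adj u v := by
    intro v hv u huv
    rw [hidx] at hv
    have := h1 (e u) (e v) huv (by omega)
    simpa using this
  refine ⟨inferInstance, ?_, ?_, hsmall⟩
  · intro v u w huv hwv hne hu hw
    rcases le_or_gt (#{x | x < v}) k with hk | hk
    · rw [hidx] at hk
      rcases lt_or_gt_of_ne hne with h | h
      · have := h1 (e u) (e w) h (by have : (e w : ℕ) < e v := hwv; omega)
        simpa using this
      · have := h1 (e w) (e u) h (by have : (e u : ℕ) < e v := huv; omega)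
        exact SimpleGraph.Adj.symm (by simpa using this)
    · rw [hidx] at hk
      obtain ⟨S, s1, s2, s3, s4⟩ := h2 (e v) hk
      have hu' := (s3 (e u) huv).1 (by simpa using hu)
      have hw' := (s3 (e w) hwv).1 (by simpa using hw)
      have := s4 _ hu' _ hw' (fun h => hne (e.injective h))
      simpa using this
  · intro v
    rcases le_or_gt (#{x | x < v}) k with hk | hk
    · rw [min_eq_left hk]
      congr 1
      ext u
      simp only [mem_filter, mem_univ, true_and]
      exact ⟨fun h => h.1, fun h => ⟨h, hsmall v hk u h⟩⟩
    · rw [min_eq_right hk.le]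
      rw [hidx] at hk
      obtain ⟨S, s1, s2, s3, s4⟩ := h2 (e v) hk
      rw [← s1, ← card_image_of_injective _ e.injective]
      congr 1
      ext i
      simp only [mem_image, mem_filter, mem_univ, true_and]
      constructor
      · rintro ⟨u, ⟨hu1, hu2⟩, rfl⟩
        exact (s3 _ hu1).1 (by simpa using hu2)
      · intro hi
        refine ⟨e.symm i, ⟨?_, ?_⟩, by simp⟩
        · rw [hlt]; simpa using s2 i hi
        · have := (s3 i (s2 i hi)).2 hi
          simpa using this

open Finset Classical in
theorem core {V : Type*} [Fintype V] [LinearOrder V] (t k d : ℕ) (htk : t ≤ k) (hd : 2 * k ≤ d)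
    (hn : 2 * k + 1 ≤ Fintype.card V) (H : SimpleGraph V)
    (hcl : ∀ v u w, u < v → w < v → u ≠ w → H.Adj u v → H.Adj w v → H.Adj u w)
    (hcard : ∀ v, #{u | u < v ∧ H.Adj u v} = min #{u | u < v} k)
    (hsmall : ∀ v, #{u | u < v} ≤ k → ∀ u, u < v → H.Adj u v) :
    ∃ S : Finset V, (∀ v ∈ S, #{u | H.Adj u v} ≤ d) ∧
      (∀ v ∈ S, #{u ∈ S | u < v ∧ H.Adj u v} ≤ t) ∧
      2 * ((t : ℤ) + 1) * (((d : ℤ) - 2 * k + 1) * Fintype.card V + k * (k + 1)) ≤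
      (#S : ℤ) * ((2 * (d : ℤ) - 3 * k + 2) * (k + 1) + t * (t + 1)) := by
  set L : Finset V := {v | #{u | H.Adj u v} ≤ d} with hL
  set m := #(Lᶜ) with hm
  set q := k - m with hq
  obtain ⟨f, hf1, hf2⟩ := firstFit H.Adj L
  have hbL : ∀ v, #{u ∈ L | u < v ∧ H.Adj u v} ≤ #{u | u < v ∧ H.Adj u v} := fun v =>
    card_le_card (filter_subset_filter _ (subset_univ _))
  have hbk : ∀ v, #{u | u < v ∧ H.Adj u v} ≤ k := fun v => by
    rw [hcard]; exact min_le_right _ _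
  have hfk : ∀ v ∈ L, f v < k + 1 := fun v hv =>
    Nat.lt_succ_of_le ((hf1 v hv).trans ((hbL v).trans (hbk v)))
  set F : V → Fin (k + 1) := fun v => if h : f v < k + 1 then ⟨f v, h⟩ else 0 with hF
  have hFf : ∀ v ∈ L, (F v : ℕ) = f v := fun v hv => by simp only [hF]; rw [dif_pos (hfk v hv)]
  obtain ⟨σ, hσ1, hσ2⟩ := sortColour L k q F
  -- colour classes
  set c : V → Fin (k + 1) := fun v => σ (F v) with hc
  have hproper : ∀ u ∈ L, ∀ v ∈ L, H.Adj u v → c u ≠ c v := by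
    intro u hu v hv huv h
    have h1 : F u = F v := σ.injective h
    have h2 : f u = f v := by rw [← hFf u hu, ← hFf v hv, h1]
    rcases lt_or_gt_of_ne huv.ne with h' | h'
    · exact hf2 u hu v hv h' huv h2
    · exact hf2 v hv u hu h' huv.symm h2.symm
  set a : ℕ → ℕ := fun i => #{v ∈ L | (c v : ℕ) = i} with ha
  have haanti : ∀ i j, i ≤ j → j ≤ k → a j ≤ a i := by
    intro i j hij hjk
    have := hσ1 ⟨i, by omega⟩ ⟨j, by omega⟩ hij
    simpa [ha, hc, Fin.ext_iff] using this
  have hsumg : ∀ (r : ℕ) (g : ℕ → ℕ), ∑ i ∈ range r, g i * a i =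
      ∑ v ∈ L with (c v : ℕ) < r, g (c v) := by
    intro r g
    rw [← sum_fiberwise_of_maps_to (s := {v ∈ L | (c v : ℕ) < r}) (t := range r)
      (g := fun v => (c v : ℕ)) (fun v hv => mem_range.2 (mem_filter.1 hv).2)]
    apply sum_congr rfl
    intro i hi
    have : ({v ∈ ({v ∈ L | (c v : ℕ) < r} : Finset V) | (c v : ℕ) = i} : Finset V) = {v ∈ L | (c v : ℕ) = i} := by
      ext v
      rw [mem_range] at hi
      simp only [mem_filter]
      constructor
      · rintro ⟨⟨h1, h2⟩, h3⟩
        exact ⟨h1, h3⟩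
      · rintro ⟨h1, h2⟩
        exact ⟨⟨h1, by omega⟩, h2⟩
    rw [this, mul_comm]
    change #{v ∈ L | (c v : ℕ) = i} * g i = _
    rw [← smul_eq_mul, ← sum_const]
    apply sum_congr rfl
    intro v hv
    rw [(mem_filter.1 hv).2]
  have hLall : ({v ∈ L | (c v : ℕ) < k + 1} : Finset V) = L :=
    filter_true_of_mem (fun v _ => (c v).2)
  have hsuma : ∀ r, ∑ i ∈ range r, a i = #{v ∈ L | (c v : ℕ) < r} := by
    intro r
    have := hsumg r (fun _ => 1)
    simpa using this
  set S : Finset V := {v ∈ L | (c v : ℕ) < t + 1} with hS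
  have hSL : S ⊆ L := filter_subset _ _
  refine ⟨S, ?_, ?_, ?_⟩
  · intro v hv
    exact (mem_filter.1 (hSL hv)).2
  · intro v hv
    have hsub : ({u ∈ S | u < v ∧ H.Adj u v} : Finset V).image (fun u => (c u : ℕ)) ⊆
        (range (t + 1)).erase (c v) := by
      intro i hi
      obtain ⟨u, hu, rfl⟩ := mem_image.1 hi
      rw [mem_filter] at hu
      rw [mem_erase, mem_range]
      refine ⟨fun h => hproper u (hSL hu.1) v (hSL hv) hu.2.2 (Fin.ext h), (mem_filter.1 hu.1).2⟩
    have hinj : Set.InjOn (fun u => (c u : ℕ)) ({u ∈ S | u < v ∧ H.Adj u v} : Finset V) := by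
      intro u hu w hw h
      rw [mem_coe, mem_filter] at hu hw
      by_contra hne
      exact hproper u (hSL hu.1) w (hSL hw.1)
        (hcl v u w hu.2.1 hw.2.1 hne hu.2.2 hw.2.2) (Fin.ext h)
    rw [← card_image_of_injOn hinj]
    refine (card_le_card hsub).trans ?_
    rw [card_erase_of_mem (mem_range.2 (mem_filter.1 hv).2), card_range]
    omega
  · have hcS : #S = ∑ i ∈ range (t + 1), a i := (hsuma _).symm
    rw [hcS]
    have hlm : #L + m = Fintype.card V := card_add_card_compl L
    have hmk : k - Fintype.card V = 0 := by omega
    have hE := sum_min k (Fintype.card V)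
    rw [hmk] at hE
    have heM := sum_min k m
    have hsx := sum_sub q #L
    apply numeric k t d (Fintype.card V) m #L (∑ v ∈ L, #{u ∈ L | u < v ∧ H.Adj u v})
      (∑ j ∈ range (Fintype.card V), min j k) (∑ j ∈ range m, min j k)
      (∑ j ∈ range #L, (q - j)) a htk hd hn hlm haanti
    · rw [hsuma, hLall]
    · rw [hsumg (k + 1) (fun i => max i (k - m)), hLall, ← idx_sum (fun j => q - j) L]
      refine hσ2.trans ?_
      rw [← sum_add_distrib]
      apply sum_le_sum
      intro v hv
      rw [hFf v hv]
      have h1 := hf1 v hv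
      have h2 : min #{u ∈ L | u < v} q ≤ #{u ∈ L | u < v ∧ H.Adj u v} := by
        rcases le_or_gt (#{u | u < v}) k with h | h
        · refine (min_le_left _ _).trans (card_le_card ?_)
          intro u hu
          rw [mem_filter] at hu ⊢
          exact ⟨hu.1, hu.2, hsmall v h u hu.2⟩
        · refine (min_le_right _ _).trans ?_
          have h3 := hcard v
          rw [min_eq_right h.le] at h3
          have h4 : ({u | u < v ∧ H.Adj u v} : Finset V) ⊆ {u ∈ L | u < v ∧ H.Adj u v} ∪ Lᶜ := by
            intro u hu
            rw [mem_filter] at hu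
            by_cases huL : u ∈ L
            · exact mem_union_left _ (mem_filter.2 ⟨huL, hu.2⟩)
            · exact mem_union_right _ (mem_compl.2 huL)
          have h5 := (card_le_card h4).trans (card_union_le _ _)
          omega
      omega
    · exact Nat.le.intro hsx
    · have hec := edge_count H L
      have h1 : (d + 1) * m ≤ ∑ v ∈ Lᶜ, #{u | H.Adj u v} := by
        rw [mul_comm, hm, ← smul_eq_mul, ← sum_const]
        apply sum_le_sum
        intro v hv
        rw [mem_compl, hL, mem_filter] at hv
        by_contra hcon
        exact hv ⟨mem_univ _, by omega⟩
      have h2 : ∑ v, #{u | u < v ∧ H.Adj u v} = ∑ j ∈ range (Fintype.card V), min j k := by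
        rw [← card_univ, ← idx_sum (fun j => min j k) univ]
        exact sum_congr rfl (fun v _ => hcard v)
      have h3 : ∑ v ∈ Lᶜ, #{u ∈ Lᶜ | u < v ∧ H.Adj u v} ≤ ∑ j ∈ range m, min j k := by
        rw [hm, ← idx_sum (fun j => min j k) Lᶜ]
        apply sum_le_sum
        intro v _
        apply le_min
        · apply card_le_card
          intro u hu
          rw [mem_filter] at hu ⊢
          exact ⟨hu.1, hu.2.1⟩
        · exact (card_le_card (filter_subset_filter _ (subset_univ _))).trans (hbk v)
      omega
    · simpa using hE
    · exact heM.le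

theorem treewidth_le {V : Type*} {G H : SimpleGraph V} {k : ℕ} (h : IsKTree k H) (hG : G ≤ H) :
    treewidth G ≤ k := Nat.sInf_le ⟨H, h, hG⟩

open Finset Classical in
theorem treewidth_le_card {V : Type*} [Fintype V] (G : SimpleGraph V) :
    treewidth G ≤ Fintype.card V - 1 ∧ (0 < Fintype.card V → ∃ H, IsKTree (treewidth G) H ∧ G ≤ H) := by
  rcases Nat.eq_zero_or_pos (Fintype.card V) with h0 | hpos
  · refine ⟨?_, fun h => absurd h (by omega)⟩
    have : IsEmpty V := Fintype.card_eq_zero_iff.1 h0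
    have hempty : {k : ℕ | ∃ H : SimpleGraph V, IsKTree k H ∧ G ≤ H} = ∅ := by
      ext k
      simp only [Set.mem_ofPred_eq, Set.mem_empty_iff_false, iff_false]
      rintro ⟨H, ⟨n, e, hn, _⟩, _⟩
      exact this.elim (e.symm ⟨0, by omega⟩)
    rw [treewidth, hempty]
    simp
  · let _ : LinearOrder V := LinearOrder.lift' (Fintype.equivFin V) (Fintype.equivFin V).injective
    obtain ⟨H, h1, h2⟩ := exists_ktree (V := V) (Fintype.card V - 1) ⊤ (by omega)
      (fun v u w _ _ h _ _ => h)
      (by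
        intro v
        refine le_trans (card_le_card (t := univ.erase v) ?_) ?_
        · intro u hu
          have hu' := (@mem_filter _ _ (_) _ _).1 hu
          exact mem_erase.2 ⟨hu'.2.1.ne, mem_univ _⟩
        rw [card_erase_of_mem (mem_univ _), card_univ])
    have hmem : Fintype.card V - 1 ∈ {k : ℕ | ∃ H : SimpleGraph V, IsKTree k H ∧ G ≤ H} :=
      ⟨H, h1, le_top.trans h2⟩
    exact ⟨Nat.sInf_le hmem, fun _ => Nat.sInf_mem ⟨_, hmem⟩⟩

/-- For all integers `0 ≤ t ≤ k`, `d ≥ 2k`, and `n ≥ 2k+1`, every graph `G`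
on `n` vertices with treewidth at most `k` contains a set `S` of vertices, each of degree at
most `d` in `G`, whose induced subgraph has treewidth at most `t`, with
`|S| ≥ ((d-2k+1)(t+1)n + k(k+1)(t+1)) / ((d - (3/2)k + 1)(k+1) + (1/2)t(t+1))`. -/
theorem stmt9 {V : Type*} [Fintype V] (t k d : ℕ) (htk : t ≤ k) (hd : 2 * k ≤ d)
    (hn : 2 * k + 1 ≤ Fintype.card V)
    (G : SimpleGraph V) (htw : treewidth G ≤ k) :
    ∃ S : Finset V,
      (∀ v ∈ S, degN G v ≤ d) ∧
      treewidth (G.induce (S : Set V)) ≤ t ∧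
      (((d : ℝ) - 2 * k + 1) * (t + 1) * Fintype.card V + (k : ℝ) * (k + 1) * (t + 1))
          / (((d : ℝ) - (3 / 2) * k + 1) * (k + 1) + (1 / 2) * t * (t + 1))
        ≤ S.card := by
  classical
  obtain ⟨H, hH, hGH⟩ : ∃ H : SimpleGraph V, IsKTree k H ∧ G ≤ H := by
    obtain ⟨H0, h1, h2⟩ := (treewidth_le_card G).2 (by omega)
    obtain ⟨_, o1, o2, o3⟩ := ktree_order _ H0 h1
    obtain ⟨H, h3, h4⟩ := exists_ktree k H0 (by omega) o1
      (fun v => by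
        rw [o2 v]
        exact (min_le_right _ _).trans htw)
    exact ⟨H, h3, h2.trans h4⟩
  obtain ⟨_, o1, o2, o3⟩ := ktree_order _ H hH
  obtain ⟨S, s1, s2, s3⟩ := core t k d htk hd hn H o1 o2 o3
  refine ⟨S, ?_, ?_, ?_⟩
  · intro v hv
    refine le_trans ?_ (s1 v hv)
    rw [degN, ← Set.ncard_coe_finset]
    apply Set.ncard_le_ncard _ (Set.toFinite _)
    intro u hu
    simpa using (hGH hu).symm
  · rcases Nat.lt_or_ge t S.card with hts | hts
    · obtain ⟨K, k1, k2⟩ := exists_ktree (V := (S : Set V)) t (H.induce (S : Set V)) (by simpa using hts)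
        (fun v u w huv hwv hne hu hw => o1 v u w huv hwv (fun h => hne (Subtype.ext h)) hu hw)
        (by
          intro v
          refine le_trans ?_ (s2 v v.2)
          apply Finset.card_le_card_of_injOn (fun u : (S : Set V) => (u : V))
          · intro u hu
            simp only [Finset.coe_filter, Finset.mem_univ, true_and, Set.mem_ofPred_eq] at hu
            simp only [Finset.coe_filter, Set.mem_ofPred_eq]
            exact ⟨u.2, hu.1, hu.2⟩
          · exact Subtype.val_injective.injOn)
      refine treewidth_le k1 (le_trans ?_ k2)
      intro u v h
      exact hGH h
    · refine (treewidth_le_card _).1.trans ?_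
      simp only [Finset.coe_sort_coe, Fintype.card_coe]
      omega
  · have hd' : (2 : ℝ) * k ≤ d := by exact_mod_cast hd
    have hpos : (0 : ℝ) < ((d : ℝ) - (3 / 2) * k + 1) * (k + 1) + (1 / 2) * t * (t + 1) := by
      have hk0 : (0 : ℝ) ≤ k := Nat.cast_nonneg _
      have : (0 : ℝ) < (d : ℝ) - (3 / 2) * k + 1 := by linarith
      positivity
    rw [div_le_iff₀ hpos]
    have s3' : 2 * ((t : ℝ) + 1) * (((d : ℝ) - 2 * k + 1) * Fintype.card V + k * (k + 1)) ≤
      (S.card : ℝ) * ((2 * (d : ℝ) - 3 * k + 2) * (k + 1) + t * (t + 1)) := by exact_mod_cast s3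
    linarith
end

section
/- Let T be a tree with n ≥ 3 vertices, and for each i let n_i be the number of vertices of T with degree exactly i. For every integer d ≥ 1, T has an independent set, all of whose vertices have degree at most d, of size at least (1/(2d-1))·( (d-1)n + 2 + Σ_{i=3}^{d} (i-2)·n_i + Σ_{i ≥ d+2} (i-d-1)·n_i ). -/
open Classical in
lemma sum_ncard_aux {V : Type*} [Fintype V] (g : V → ℕ) (f : ℕ → ℝ) (a b : ℕ) :
    ∑ i ∈ Finset.Icc a b, f i * ({v : V | g v = i}.ncard : ℝ)
      = ∑ v : V, if a ≤ g v ∧ g v ≤ b then f (g v) else 0 := by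
  have h : ∀ i, f i * ({v : V | g v = i}.ncard : ℝ) = ∑ v : V, if g v = i then f i else 0 := by
    intro i
    rw [← Finset.sum_filter, Finset.sum_const, nsmul_eq_mul, mul_comm, Set.ncard_eq_toFinset_card']
    congr 3
    ext v
    simp
  simp_rw [h]
  rw [Finset.sum_comm]
  refine Finset.sum_congr rfl fun v _ => ?_
  rw [Finset.sum_ite_eq]
  simp [Finset.mem_Icc]

lemma degN_eq_degree {V : Type*} (G : SimpleGraph V) (v : V) [Fintype (G.neighborSet v)] :
    degN G v = G.degree v := by
  rw [degN, Set.ncard_eq_toFinset_card', ← SimpleGraph.card_neighborFinset_eq_degree]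
  rfl

/-- Two adjacent leaves fill a connected graph. -/
lemma leaves_not_adj {V : Type*} [Fintype V] (T : SimpleGraph V) (hc : T.Connected)
    (hn : 3 ≤ Fintype.card V) (v w : V) (hv : degN T v = 1) (hw : degN T w = 1) :
    ¬ T.Adj v w := by
  classical
  intro hvw
  rw [degN_eq_degree, SimpleGraph.degree_eq_one_iff_existsUnique_adj] at hv hw
  have key : ∀ a b, T.Walk a b → (a = v ∨ a = w) → (b = v ∨ b = w) := by
    intro a b p
    induction p with
    | nil => exact id
    | cons h p ih =>
      intro ha
      apply ih
      rcases ha with rfl | rfl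
      · exact Or.inr (hv.unique h hvw)
      · exact Or.inl (hw.unique h hvw.symm)
  have hsub : (Finset.univ : Finset V) ⊆ {v, w} := by
    intro x _
    obtain ⟨p⟩ := hc.preconnected v x
    simpa using key v x p (Or.inl rfl)
  have h1 := Finset.card_le_card hsub
  have h2 := Finset.card_le_two (a := v) (b := w)
  rw [Finset.card_univ] at h1
  omega

/-- Let `T` be a tree with `n ≥ 3` vertices and let `n_i` be the number of
vertices of `T` of degree exactly `i`. For every integer `d ≥ 1`, `T` has a degree-`d`
independent set of size at least
`(1/(2d-1))·((d-1)n + 2 + Σ_{i=3}^{d} (i-2)·n_i + Σ_{i≥d+2} (i-d-1)·n_i)`.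
(Since every degree is less than `n`, the last sum may be truncated at `i = n`.) -/
theorem stmt12 {V : Type*} [Fintype V] (d : ℕ) (hd : 1 ≤ d) (T : SimpleGraph V)
    (hT : T.IsTree) (hn : 3 ≤ Fintype.card V) :
    ∃ S : Finset V,
      (∀ v ∈ S, ∀ w ∈ S, ¬ T.Adj v w) ∧
      (∀ v ∈ S, degN T v ≤ d) ∧
      (1 / (2 * (d : ℝ) - 1)) *
        (((d : ℝ) - 1) * Fintype.card V + 2
          + ∑ i ∈ Finset.Icc 3 d,
              ((i : ℝ) - 2) * ({v : V | degN T v = i}.ncard : ℝ)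
          + ∑ i ∈ Finset.Icc (d + 2) (Fintype.card V),
              ((i : ℝ) - (d : ℝ) - 1) * ({v : V | degN T v = i}.ncard : ℝ))
        ≤ S.card := by
  classical
  have hcardR : ∀ (P : V → Prop) [DecidablePred P], ((Finset.univ.filter P).card : ℝ) = ∑ v : V, if P v then 1 else 0 := by
    intro P _
    simp
  have hnt : Nontrivial V := Fintype.one_lt_card_iff_nontrivial.mp (by omega)
  have hpos : ∀ v, 1 ≤ degN T v := fun v => by
    rw [degN_eq_degree]
    exact hT.connected.preconnected.degree_pos_of_nontrivial v
  have hlt : ∀ v, degN T v ≤ Fintype.card V := fun v => by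
    rw [degN_eq_degree]
    exact (T.degree_lt_card_verts v).le
  have hsum : ∑ v : V, ((degN T v : ℝ) - 2) = -2 := by
    have h1 := T.sum_degrees_eq_twice_card_edges
    have h2 := hT.card_edgeFinset
    have h3 : ∑ v : V, degN T v + 2 = 2 * Fintype.card V := by
      simp_rw [degN_eq_degree]
      omega
    have h4 : ∑ v : V, (degN T v : ℝ) + 2 = 2 * Fintype.card V := by exact_mod_cast h3
    rw [Finset.sum_sub_distrib, Finset.sum_const, Finset.card_univ, nsmul_eq_mul]
    linarith
  -- the bracket equals (d-1) * #(low degree) + #leaves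
  have hbr : ((d : ℝ) - 1) * Fintype.card V + 2
          + ∑ i ∈ Finset.Icc 3 d,
              ((i : ℝ) - 2) * ({v : V | degN T v = i}.ncard : ℝ)
          + ∑ i ∈ Finset.Icc (d + 2) (Fintype.card V),
              ((i : ℝ) - (d : ℝ) - 1) * ({v : V | degN T v = i}.ncard : ℝ)
      = ((d : ℝ) - 1) * (Finset.univ.filter fun v => degN T v ≤ d).card
        + (Finset.univ.filter fun v => degN T v = 1).card := by
    rw [sum_ncard_aux (degN T) (fun i => (i : ℝ) - 2),
      sum_ncard_aux (degN T) (fun i => (i : ℝ) - (d : ℝ) - 1), hcardR, hcardR]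
    have hc : ((d : ℝ) - 1) * Fintype.card V = ∑ v : V, ((d : ℝ) - 1) := by
      rw [Finset.sum_const, Finset.card_univ, nsmul_eq_mul, mul_comm]
    have h2 : (2 : ℝ) = - ∑ v : V, ((degN T v : ℝ) - 2) := by rw [hsum]; norm_num
    rw [hc]
    nth_rewrite 1 [h2]
    rw [Finset.mul_sum, ← Finset.sum_neg_distrib, ← Finset.sum_add_distrib,
      ← Finset.sum_add_distrib, ← Finset.sum_add_distrib, ← Finset.sum_add_distrib]
    refine Finset.sum_congr rfl fun v _ => ?_
    have ha := hpos v
    have hb := hlt v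
    generalize degN T v = g at ha hb ⊢
    rcases Nat.lt_or_ge g 3 with hg | hg
    · have : g = 1 ∨ g = 2 := by omega
      rcases this with rfl | rfl
      · simp [hd]
        norm_num
      · rcases Nat.lt_or_ge d 2 with hd2 | hd2
        · have : d = 1 := by omega
          subst this
          norm_num
        · simp [hd2]
          omega
    · have h1 : g ≠ 1 := by omega
      rcases Nat.lt_or_ge d g with h | h
      · have h3 : ¬ g ≤ d := by omega
        rcases Nat.lt_or_ge g (d + 2) with h4 | h4
        · have : g = d + 1 := by omega
          subst this
          simp
          split_ifs
          · omega
          · push_cast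
            ring
        · simp [h1, h3, h4, hb]
          ring
      · have h4 : ¬ d + 2 ≤ g := by omega
        simp [h1, h, h4, hg]
        ring
  rw [hbr]
  have hd' : (1 : ℝ) ≤ d := by exact_mod_cast hd
  have hD : 0 < 2 * (d : ℝ) - 1 := by linarith
  have c := hT.coloringTwo
  by_contra hcon
  push Not at hcon
  set L : ℝ := ((Finset.univ.filter fun v => degN T v = 1).card : ℝ) with hL
  set M : ℝ := ((Finset.univ.filter fun v => degN T v ≤ d).card : ℝ) with hM
  have e1 : L < 1 / (2 * (d : ℝ) - 1) * (((d : ℝ) - 1) * M + L) := by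
    apply hcon
    · intro v hv w hw
      exact leaves_not_adj T hT.connected hn v w (by simpa using hv) (by simpa using hw)
    · intro v hv
      have : degN T v = 1 := by simpa using hv
      omega
  have e2 : ∀ k : Fin 2, ((Finset.univ.filter fun v => degN T v ≤ d ∧ c v = k).card : ℝ)
      < 1 / (2 * (d : ℝ) - 1) * (((d : ℝ) - 1) * M + L) := by
    intro k
    apply hcon
    · intro v hv w hw hvw
      simp only [Finset.mem_filter, Finset.mem_univ, true_and] at hv hw
      exact c.valid hvw (hv.2.trans hw.2.symm)
    · intro v hv
      simp only [Finset.mem_filter, Finset.mem_univ, true_and] at hv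
      exact hv.1
  have e3 : M = ((Finset.univ.filter fun v => degN T v ≤ d ∧ c v = 0).card : ℝ)
      + ((Finset.univ.filter fun v => degN T v ≤ d ∧ c v = 1).card : ℝ) := by
    rw [hM, hcardR, hcardR, hcardR, ← Finset.sum_add_distrib]
    refine Finset.sum_congr rfl fun v _ => ?_
    have : c v = 0 ∨ c v = 1 := by
      generalize c v = k
      fin_cases k <;> simp
    rcases this with h | h <;> simp [h]
  have e4 := e2 0
  have e5 := e2 1
  rw [one_div_mul_eq_div] at e1 e4 e5
  set q := (((d : ℝ) - 1) * M + L) / (2 * (d : ℝ) - 1) with hq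
  have e6 : q * (2 * (d : ℝ) - 1) = ((d : ℝ) - 1) * M + L := div_mul_cancel₀ _ hD.ne'
  have e7 : M ≤ 2 * q := by linarith
  nlinarith [mul_le_mul_of_nonneg_left e7 (by linarith : (0 : ℝ) ≤ d - 1)]
end
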